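/- Let R be an integral domain which contains an infinite field (i.e., there is an infinite subfield k ⊆ R). Then I(R) is independent. -/

import Mathlib

/-- A family `F` of subsets is independent if whenever `X, X₁, …, Xₙ ∈ F`
satisfy `X = X₁ ∪ … ∪ Xₙ`, then `X = Xᵢ` for some `i`. -/
def IsIndependentFamily {α : Type*} (F : Set (Set α)) : Prop :=
  ∀ (X : Set α) (n : ℕ) (Xs : Fin (n + 1) → Set α),
    X ∈ F → (∀ i, Xs i ∈ F) → X = ⋃ i, Xs i → ∃ i, X = Xs i

/-- The family of constructible ring-theoretic ideals
`I(R) = { c⁻¹(a₁R ∩ … ∩ aₙR) : n ≥ 1, a₁,…,aₙ,c ∈ R∖{0} }`. -/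
def cI (R : Type*) [CommRing R] : Set (Set R) :=
  { I | ∃ (n : ℕ) (a : Fin (n + 1) → R) (c : R), (∀ i, a i ≠ 0) ∧ c ≠ 0 ∧
      I = { r : R | ∀ i, ∃ t : R, c * r = a i * t } }

/-- Every constructible ideal is the underlying set of an ideal. -/
theorem exists_ideal_of_mem_cI {R : Type*} [CommRing R] {I : Set R} (hI : I ∈ cI R) :
    ∃ J : Ideal R, (J : Set R) = I := by
  obtain ⟨n, a, c, -, -, rfl⟩ := hI
  refine ⟨⨅ i, Submodule.comap (LinearMap.mulLeft R c) (Ideal.span {a i}), ?_⟩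
  ext r
  simp [Ideal.mem_span_singleton, dvd_def]

/-- A subspace over an infinite field that is a finite union of subspaces equals one of them. -/
theorem Subspace.exists_eq_of_coe_eq_iUnion {K E ι : Type*} [Field K] [Infinite K]
    [AddCommGroup E] [Module K E] [Finite ι] {W : Submodule K E} {p : ι → Submodule K E}
    (h : (W : Set E) = ⋃ i, (p i : Set E)) : ∃ i, W = p i := by
  have hcover : ⋃ i, ((p i).comap W.subtype : Set W) = Set.univ := by
    refine Set.eq_univ_of_forall fun x => ?_
    have hx : (x : E) ∈ ⋃ i, (p i : Set E) := h ▸ x.2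
    simpa using hx
  obtain ⟨i, hi⟩ := Subspace.exists_eq_top_of_iUnion_eq_univ hcover
  refine ⟨i, le_antisymm (Submodule.comap_subtype_eq_top.mp hi) ?_⟩
  rw [← SetLike.coe_subset_coe, h]
  exact Set.subset_iUnion (fun i => (p i : Set E)) i

/-- If an integral domain `R` contains an infinite field,
then `I(R)` is independent. -/
theorem independent_of_contains_infinite_field (R : Type*) [CommRing R] [IsDomain R]
    (k : Subring R) (hk : IsField k) (hki : (k : Set R).Infinite) :
    IsIndependentFamily (cI R) := by
  intro X n Xs hX hXs h
  let _ : Field k := hk.toField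
  have : Infinite k := hki.to_subtype
  obtain ⟨W, rfl⟩ := exists_ideal_of_mem_cI hX
  choose p hp using fun i => exists_ideal_of_mem_cI (hXs i)
  obtain rfl : (fun i => (p i : Set R)) = Xs := funext hp
  obtain ⟨i, hi⟩ := Subspace.exists_eq_of_coe_eq_iUnion (K := k)
    (W := W.restrictScalars k) (p := fun i => (p i).restrictScalars k) h
  exact ⟨i, congrArg (fun V : Submodule k R => (V : Set R)) hi⟩
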